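/- Let μ be a finite signed Borel measure on [0,1]. Then V₀(μ) ≤ V(μ) ≤ 2·V₀(μ) + 2·‖μ‖. -/

import Mathlib

open MeasureTheory Set

/-- Integral of a function against a finite signed Borel measure, via the Jordan
decomposition. -/
noncomputable def sInt (μ : SignedMeasure ℝ) (f : ℝ → ℝ) : ℝ :=
  (∫ x, f x ∂μ.toJordanDecomposition.posPart) - ∫ x, f x ∂μ.toJordanDecomposition.negPart

/-- A signed measure on `ℝ` is concentrated on `[0,1]` (i.e. it is a finite signed Borel
measure on `[0,1]`). -/
def ConcOnUnit (μ : SignedMeasure ℝ) : Prop :=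
  μ.toJordanDecomposition.posPart (Icc (0:ℝ) 1)ᶜ = 0 ∧
  μ.toJordanDecomposition.negPart (Icc (0:ℝ) 1)ᶜ = 0

/-- The variation `V(μ) = sup {∫ φ' dμ : φ ∈ C¹([0,1]), |φ| ≤ 1}`. -/
noncomputable def Vvar (μ : SignedMeasure ℝ) : ℝ :=
  sSup {y | ∃ φ : ℝ → ℝ, ContDiff ℝ 1 φ ∧ (∀ x ∈ Icc (0:ℝ) 1, |φ x| ≤ 1) ∧
    y = sInt μ (deriv φ)}

/-- The boundary-vanishing variation
`V₀(μ) = sup {∫ φ' dμ : φ ∈ C¹([0,1]), |φ| ≤ 1, φ(0) = φ(1) = 0}`. -/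
noncomputable def Vvar0 (μ : SignedMeasure ℝ) : ℝ :=
  sSup {y | ∃ φ : ℝ → ℝ, ContDiff ℝ 1 φ ∧ (∀ x ∈ Icc (0:ℝ) 1, |φ x| ≤ 1) ∧
    φ 0 = 0 ∧ φ 1 = 0 ∧ y = sInt μ (deriv φ)}

/-- The weak norm `‖μ‖ = sup {∫ φ dμ : φ bounded measurable, |φ| ≤ 1}` (the total
variation norm). -/
noncomputable def weakNorm (μ : SignedMeasure ℝ) : ℝ :=
  sSup {y | ∃ φ : ℝ → ℝ, Measurable φ ∧ (∀ x, |φ x| ≤ 1) ∧ y = sInt μ φ}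

theorem Continuous.integrable_of_measure_compl_eq_zero {f : ℝ → ℝ} (hf : Continuous f)
    {ν : Measure ℝ} [IsFiniteMeasure ν] {K : Set ℝ} (hK : IsCompact K) (hν : ν Kᶜ = 0) :
    Integrable f ν := by
  rw [← Measure.restrict_eq_self_of_ae_mem (s := K) (μ := ν) (mem_ae_iff.2 hν)]
  exact hf.continuousOn.integrableOn_compact hK

theorem sInt_le_mass (μ : SignedMeasure ℝ) {f : ℝ → ℝ} (hf : ∀ x, |f x| ≤ 1) :
    sInt μ f ≤ μ.toJordanDecomposition.posPart.real univ +
      μ.toJordanDecomposition.negPart.real univ := by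
  have h (ν : Measure ℝ) [IsFiniteMeasure ν] : |∫ x, f x ∂ν| ≤ ν.real univ := by
    simpa using norm_integral_le_of_norm_le_const (μ := ν) (f := f) (C := 1)
      (Filter.Eventually.of_forall hf)
  have hp := abs_le.1 (h μ.toJordanDecomposition.posPart)
  have hn := abs_le.1 (h μ.toJordanDecomposition.negPart)
  unfold sInt
  linarith

theorem sInt_le_weakNorm (μ : SignedMeasure ℝ) {f : ℝ → ℝ} (hf : Measurable f)
    (hb : ∀ x, |f x| ≤ 1) : sInt μ f ≤ weakNorm μ := by
  refine le_csSup ⟨μ.toJordanDecomposition.posPart.real univ +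
    μ.toJordanDecomposition.negPart.real univ, ?_⟩ ⟨f, hf, hb, rfl⟩
  rintro y ⟨φ, -, hφ, rfl⟩
  exact sInt_le_mass μ hφ

theorem sInt_two_mul_add_const {μ : SignedMeasure ℝ} (hμ : ConcOnUnit μ) {f : ℝ → ℝ}
    (hf : Continuous f) (c : ℝ) :
    sInt μ (fun x => 2 * f x + 2 * c) = 2 * sInt μ f + 2 * sInt μ (fun _ => c) := by
  have h (ν : Measure ℝ) [IsFiniteMeasure ν] (hν : ν (Icc 0 1)ᶜ = 0) :
      ∫ x, (2 * f x + 2 * c) ∂ν = 2 * ∫ x, f x ∂ν + 2 * ∫ _, c ∂ν := by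
    rw [integral_add ((hf.integrable_of_measure_compl_eq_zero isCompact_Icc hν).const_mul 2)
      (integrable_const _), integral_const_mul, integral_const_mul]
  unfold sInt
  rw [h _ hμ.1, h _ hμ.2]
  ring

/-- Subtracting the affine interpolant of the boundary values and halving turns a test function
into a boundary-vanishing one. -/
theorem exists_boundary_vanishing_split {μ : SignedMeasure ℝ} (hμ : ConcOnUnit μ) {φ : ℝ → ℝ}
    (hφ : ContDiff ℝ 1 φ) (hb : ∀ x ∈ Icc (0:ℝ) 1, |φ x| ≤ 1) :
    ∃ (χ : ℝ → ℝ) (c : ℝ), ContDiff ℝ 1 χ ∧ (∀ x ∈ Icc (0:ℝ) 1, |χ x| ≤ 1) ∧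
      χ 0 = 0 ∧ χ 1 = 0 ∧ |c| ≤ 1 ∧
      sInt μ (deriv φ) = 2 * sInt μ (deriv χ) + 2 * sInt μ (fun _ => c) := by
  have h0 := abs_le.1 (hb 0 (by simp))
  have h1 := abs_le.1 (hb 1 (by simp))
  set a := φ 0 with ha
  set b := φ 1 with hb1
  have hχ : ContDiff ℝ 1 fun x => (φ x - (a + (b - a) * x)) / 2 := by fun_prop
  refine ⟨_, (b - a) / 2, hχ, fun x hx => ?_, by simp [ha], by simp [hb1], ?_, ?_⟩
  · have h := abs_le.1 (hb x hx)
    obtain ⟨hx0, hx1⟩ := hx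
    rw [abs_le]
    constructor <;> nlinarith
  · rw [abs_le]
    constructor <;> linarith
  · rw [← sInt_two_mul_add_const hμ (hχ.continuous_deriv le_rfl)]
    congr 1
    ext x
    have hd : HasDerivAt (fun x => (φ x - (a + (b - a) * x)) / 2)
        ((deriv φ x - (b - a) * 1) / 2) x :=
      (((hφ.differentiable one_ne_zero x).hasDerivAt).sub
        (((hasDerivAt_id x).const_mul (b - a)).const_add a)).div_const 2
    rw [hd.deriv]
    ring

/-- For a finite signed Borel measure on `[0,1]`: `V₀(μ) ≤ V(μ) ≤ 2·V₀(μ) + 2·‖μ‖`. -/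
theorem variation_comparison (μ : SignedMeasure ℝ) (hμ : ConcOnUnit μ) :
    Vvar0 μ ≤ Vvar μ ∧ Vvar μ ≤ 2 * Vvar0 μ + 2 * weakNorm μ := by
  have h_zero : (0 : ℝ) ∈ {y | ∃ φ : ℝ → ℝ, ContDiff ℝ 1 φ ∧
      (∀ x ∈ Icc (0:ℝ) 1, |φ x| ≤ 1) ∧ φ 0 = 0 ∧ φ 1 = 0 ∧ y = sInt μ (deriv φ)} :=
    ⟨fun _ => 0, contDiff_const, by simp, rfl, rfl, by simp [sInt]⟩
  have h_sub : {y | ∃ φ : ℝ → ℝ, ContDiff ℝ 1 φ ∧ (∀ x ∈ Icc (0:ℝ) 1, |φ x| ≤ 1) ∧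
      φ 0 = 0 ∧ φ 1 = 0 ∧ y = sInt μ (deriv φ)} ⊆
      {y | ∃ φ : ℝ → ℝ, ContDiff ℝ 1 φ ∧ (∀ x ∈ Icc (0:ℝ) 1, |φ x| ≤ 1) ∧
        y = sInt μ (deriv φ)} := by
    rintro y ⟨φ, hφ, hb, -, -, rfl⟩
    exact ⟨φ, hφ, hb, rfl⟩
  have h_upper (hbdd : BddAbove {y | ∃ φ : ℝ → ℝ, ContDiff ℝ 1 φ ∧
      (∀ x ∈ Icc (0:ℝ) 1, |φ x| ≤ 1) ∧ φ 0 = 0 ∧ φ 1 = 0 ∧ y = sInt μ (deriv φ)}) :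
      ∀ y ∈ {y | ∃ φ : ℝ → ℝ, ContDiff ℝ 1 φ ∧ (∀ x ∈ Icc (0:ℝ) 1, |φ x| ≤ 1) ∧
        y = sInt μ (deriv φ)}, y ≤ 2 * Vvar0 μ + 2 * weakNorm μ := by
    rintro y ⟨φ, hφ, hb, rfl⟩
    obtain ⟨χ, c, hχ, hχb, hχ0, hχ1, hc, h_eq⟩ := exists_boundary_vanishing_split hμ hφ hb
    have h₀ : sInt μ (deriv χ) ≤ Vvar0 μ := le_csSup hbdd ⟨χ, hχ, hχb, hχ0, hχ1, rfl⟩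
    have h₁ := sInt_le_weakNorm μ (measurable_const (a := c)) fun _ => hc
    linarith
  by_cases hbdd : BddAbove {y | ∃ φ : ℝ → ℝ, ContDiff ℝ 1 φ ∧
      (∀ x ∈ Icc (0:ℝ) 1, |φ x| ≤ 1) ∧ φ 0 = 0 ∧ φ 1 = 0 ∧ y = sInt μ (deriv φ)}
  · exact ⟨csSup_le_csSup ⟨_, h_upper hbdd⟩ ⟨0, h_zero⟩ h_sub,
      csSup_le ⟨0, h_sub h_zero⟩ (h_upper hbdd)⟩
  · have h₀ : Vvar0 μ = 0 := Real.sSup_of_not_bddAbove hbdd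
    have h₁ : Vvar μ = 0 := Real.sSup_of_not_bddAbove fun h => hbdd (h.mono h_sub)
    have h₂ : 0 ≤ weakNorm μ := by
      simpa [sInt] using sInt_le_weakNorm μ (measurable_const (a := (0 : ℝ))) (by simp)
    rw [h₀, h₁]
    exact ⟨le_rfl, by linarith⟩
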